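/- arXiv:2206.13625 — 2 statements merged into one kernel-verified Lean document; each statement's English description precedes it below -/
import Mathlib

section
/- The only Fibonacci numbers which are concatenations (in base 10) of a Fibonacci number followed by a Lucas number are 1, 2, 3, 13, 21, and 34. -/
def lucas : ℕ → ℕ
  | 0 => 2
  | 1 => 1
  | n + 2 => lucas (n + 1) + lucas n

/-! ### Elementary facts on Lucas numbers -/

theorem lucas_succ (n : ℕ) : lucas (n + 1) = Nat.fib n + Nat.fib (n + 2) := by
  induction n using Nat.twoStepInduction with
  | zero => decide
  | one => decide
  | more n ih1 ih2 =>
    have h1 := Nat.fib_add_two (n := n)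
    have h2 := Nat.fib_add_two (n := n + 2)
    rw [lucas, ih1, ih2]
    simp only [add_assoc, Nat.reduceAdd] at *
    omega

theorem lucas_add_fib (n : ℕ) : lucas n + Nat.fib n = 2 * Nat.fib (n + 1) := by
  cases n with
  | zero => decide
  | succ n => rw [lucas_succ, Nat.fib_add_two (n := n)]; ring

theorem lucas_cast (n : ℕ) : (lucas n : ℤ) = 2 * Nat.fib (n + 1) - Nat.fib n := by
  have := lucas_add_fib n
  push_cast [← @Nat.cast_inj ℤ] at this
  linarith

theorem lucas_pos (n : ℕ) : 0 < lucas n := by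
  cases n with
  | zero => decide
  | succ n => rw [lucas_succ]; have := Nat.fib_pos.2 (show 0 < n + 2 by omega); omega

theorem fib_le_lucas (n : ℕ) : Nat.fib n ≤ lucas n := by
  have := lucas_add_fib n
  have := Nat.fib_le_fib_succ (n := n)
  omega

theorem fib_add_cast (a b : ℕ) : (Nat.fib (a + b) : ℤ) =
    Nat.fib a * Nat.fib (b + 1) + (Nat.fib (a + 1) - Nat.fib a) * Nat.fib b := by
  cases b with
  | zero => simp
  | succ b =>
    have := Nat.fib_add a b
    rw [← add_assoc, this, Nat.fib_add_two (n := b)]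
    push_cast
    ring

theorem fib_cassini (n : ℕ) :
    (Nat.fib (n + 1) : ℤ) ^ 2 - Nat.fib (n + 1) * Nat.fib n - (Nat.fib n : ℤ) ^ 2 = (-1) ^ n := by
  induction n with
  | zero => simp
  | succ n ih =>
    rw [Nat.fib_add_two (n := n), pow_succ _ n, ← ih]
    push_cast
    ring

theorem fib_add_two_mul (u s : ℕ) : (Nat.fib (u + s + s) : ℤ) =
    lucas s * Nat.fib (u + s) - (-1) ^ s * Nat.fib u := by
  have h1 := fib_add_cast u s
  have h2 := fib_add_cast (u + s) s
  have h3 : (Nat.fib (u + s + 1) : ℤ) = Nat.fib u * Nat.fib s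
      + Nat.fib (u + 1) * Nat.fib (s + 1) := by exact_mod_cast Nat.fib_add u s
  rw [h2, h3, h1, lucas_cast, ← fib_cassini]
  ring

/-- From the third one on, the Lucas numbers lie strictly between consecutive Fibonacci numbers. -/
theorem lt_three_of_lucas_eq_fib {k n : ℕ} (h : lucas k = Nat.fib n) : k < 3 := by
  by_contra! hk
  obtain ⟨k, rfl⟩ := Nat.exists_eq_add_of_le' hk
  have h1 : lucas (k + 3) = Nat.fib (k + 2) + Nat.fib (k + 4) := lucas_succ (k + 2)
  have h2 : 0 < Nat.fib (k + 2) := Nat.fib_pos.2 (by omega)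
  have h3 : Nat.fib (k + 2) < Nat.fib (k + 3) := Nat.fib_lt_fib_succ (by omega)
  have h4 : Nat.fib (k + 5) = Nat.fib (k + 3) + Nat.fib (k + 4) := Nat.fib_add_two
  have h5 : Nat.fib (k + 4) < Nat.fib n := by
    rw [← h, h1]; omega
  have h6 : Nat.fib n < Nat.fib (k + 5) := by
    rw [← h, h1, h4]; omega
  have h7 := Nat.fib_mono.reflect_lt h5
  have h8 := Nat.fib_mono.reflect_lt h6
  omega

/-! ### Comparison of the indices -/

theorem add_le_of_lucas_mul_fib_lt {n m k : ℕ} (hm : 1 ≤ m)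
    (h : lucas k * Nat.fib m < Nat.fib n) : k + m ≤ n := by
  obtain ⟨m, rfl⟩ := Nat.exists_eq_add_of_le' hm
  cases k with
  | zero =>
    have := Nat.fib_mono.reflect_lt (lt_of_le_of_lt (Nat.le_mul_of_pos_left _ (lucas_pos 0)) h)
    omega
  | succ k =>
    have h1 : Nat.fib (k + m + 1) < Nat.fib n := by
      refine lt_of_le_of_lt ?_ h
      rw [Nat.fib_add, lucas_succ, add_mul]
      exact Nat.add_le_add (Nat.mul_le_mul_left _ Nat.fib_le_fib_succ)
        (Nat.mul_le_mul_right _ (Nat.fib_mono (by omega)))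
    have := Nat.fib_mono.reflect_lt h1
    omega

theorem lt_add_six_of_fib_le {n x : ℕ} (hx : 1 ≤ x) (h : Nat.fib n ≤ 12 * Nat.fib x) :
    n < x + 6 := by
  by_contra! hn
  have h1 : Nat.fib (x + 6) ≤ Nat.fib n := Nat.fib_mono hn
  have h2 : Nat.fib (x + 5 + 1) = _ := Nat.fib_add x 5
  have h3 : 0 < Nat.fib x := Nat.fib_pos.2 hx
  have h4 : Nat.fib x ≤ Nat.fib (x + 1) := Nat.fib_le_fib_succ
  have h5 : Nat.fib 5 = 5 := by decide
  have h6 : Nat.fib (5 + 1) = 8 := by decide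
  rw [h5, h6] at h2
  simp only [add_assoc, Nat.reduceAdd] at h2
  omega

theorem lucas_mul_fib_le {k : ℕ} (hk : 1 ≤ k) (m : ℕ) :
    lucas k * Nat.fib m ≤ Nat.fib (k + m + 1) := by
  obtain ⟨k, rfl⟩ := Nat.exists_eq_add_of_le' hk
  have h2 := Nat.fib_add_two (n := k)
  have h3 : Nat.fib m ≤ Nat.fib (m + 1) := Nat.fib_le_fib_succ
  have h4 := Nat.fib_le_fib_succ (n := k)
  rw [Nat.fib_add, lucas_succ, add_assoc k 1 1]
  nlinarith [Nat.zero_le (Nat.fib (k + 2))]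

/-! ### Divisibility by a large Fibonacci number -/

theorem not_dvd_of_pos_lt {a b : ℤ} (h1 : 0 < b) (h2 : b < a) : ¬ a ∣ b :=
  fun h => absurd (Int.le_of_dvd h1 h) (by omega)

theorem not_fib_dvd_lucas_add_small {m r : ℕ} {c : ℤ} (hm : 14 ≤ m) (hr : r < m) (hr' : 6 ≤ r)
    (hc : |c| ≤ 5) : ¬ (Nat.fib m : ℤ) ∣ lucas r + c := by
  obtain ⟨hc1, hc2⟩ := abs_le.1 hc
  obtain ⟨m, rfl⟩ := Nat.exists_eq_add_of_le' (show 4 ≤ m by omega)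
  have e2 := Nat.fib_add_two (n := m)
  have e3 := Nat.fib_add_two (n := m + 1)
  have e4 := Nat.fib_add_two (n := m + 2)
  simp only [add_assoc, Nat.reduceAdd] at e2 e3 e4
  have hm10 : 55 ≤ Nat.fib m := Nat.fib_mono (show 10 ≤ m by omega)
  have hm11 : Nat.fib m ≤ Nat.fib (m + 1) := Nat.fib_le_fib_succ
  have hlow : 8 ≤ lucas r := (Nat.fib_mono hr').trans (fib_le_lucas r)
  rcases Nat.lt_or_ge r (m + 3) with h | h
  · have h1 : lucas r ≤ Nat.fib (m + 1) + Nat.fib (m + 3) := by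
      obtain ⟨r, rfl⟩ := Nat.exists_eq_add_of_le' (show 1 ≤ r by omega)
      rw [lucas_succ]
      exact Nat.add_le_add (Nat.fib_mono (by omega)) (Nat.fib_mono (by omega))
    apply not_dvd_of_pos_lt <;> omega
  · obtain rfl : r = m + 3 := by omega
    intro hd
    have h1 := lucas_succ (m + 2)
    simp only [add_assoc, Nat.reduceAdd] at h1
    have h2 : (Nat.fib (m + 4) : ℤ) ∣ Nat.fib (m + 2) + c := by
      rw [h1] at hd
      push_cast at hd
      rw [add_right_comm] at hd
      exact (dvd_add_left dvd_rfl).1 hd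
    revert h2
    apply not_dvd_of_pos_lt <;> omega

theorem lucas_add_fib_lt {m r u : ℕ} (hm : 6 ≤ m) (hr : 2 ≤ r) (hu : 3 ≤ u) (h : r + u ≤ m) :
    lucas r + Nat.fib u < Nat.fib m := by
  obtain ⟨r, rfl⟩ := Nat.exists_eq_add_of_le' hr
  obtain ⟨u, rfl⟩ := Nat.exists_eq_add_of_le' hu
  have h1 : Nat.fib (r + 1 + (u + 3) + 1) ≤ Nat.fib m := Nat.fib_mono (by omega)
  rw [Nat.fib_add] at h1
  have h2 := lucas_succ (r + 1)
  have h3 : Nat.fib (r + 1 + 2) = _ := Nat.fib_add_two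
  have hA : 1 ≤ Nat.fib (r + 1) := Nat.fib_pos.2 (by omega)
  have hD : 3 ≤ Nat.fib (u + 3 + 1) := Nat.fib_mono (show 4 ≤ u + 3 + 1 by omega)
  rw [h2, h3]
  rcases Nat.eq_zero_or_pos r with rfl | hr
  · rcases Nat.eq_zero_or_pos u with rfl | hu
    · have : Nat.fib 6 ≤ Nat.fib m := Nat.fib_mono hm
      exact lt_of_lt_of_le (by decide) this
    · have : 5 ≤ Nat.fib (u + 3 + 1) := Nat.fib_mono (show 5 ≤ u + 3 + 1 by omega)
      norm_num at h1 ⊢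
      omega
  · have hB : Nat.fib (r + 1) < Nat.fib (r + 1 + 1) := Nat.fib_lt_fib_succ (by omega)
    nlinarith

theorem not_fib_dvd_lucas_add_fib {m r u j : ℕ} {e : ℤ} (hm : 14 ≤ m) (hj : j ≤ 6) (hr : r < m)
    (he : |e| = 1) (h : r + j + u = m) :
    ¬ (Nat.fib m : ℤ) ∣ lucas r + e * Nat.fib u := by
  have habs : |e * (Nat.fib u : ℤ)| = Nat.fib u := by rw [abs_mul, he, one_mul, Nat.abs_cast]
  rcases Nat.lt_or_ge u 3 with hu | hu
  · refine not_fib_dvd_lucas_add_small hm hr (by omega) ?_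
    rw [habs]
    have : Nat.fib u ≤ Nat.fib 3 := Nat.fib_mono hu.le
    have h3 : Nat.fib 3 = 2 := by decide
    omega
  suffices hs : lucas r + Nat.fib u < Nat.fib m ∧ lucas r < Nat.fib u ∨
      lucas r + Nat.fib u < Nat.fib m ∧ 3 ≤ r ∨ j = 0 ∧ r = 0 by
    rcases hs with ⟨h1, h2⟩ | ⟨h1, h2⟩ | ⟨rfl, rfl⟩
    all_goals intro hd
    · have h0 := Int.eq_zero_of_abs_lt_dvd hd
        ((abs_add_le _ _).trans_lt (by rw [habs, Nat.abs_cast]; exact_mod_cast h1))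
      rw [eq_neg_of_add_eq_zero_right h0, abs_neg, Nat.abs_cast] at habs
      omega
    · have h0 := Int.eq_zero_of_abs_lt_dvd hd
        ((abs_add_le _ _).trans_lt (by rw [habs, Nat.abs_cast]; exact_mod_cast h1))
      rw [eq_neg_of_add_eq_zero_right h0, abs_neg, Nat.abs_cast] at habs
      have := lt_three_of_lucas_eq_fib (Int.ofNat.inj habs)
      omega
    · obtain rfl : u = m := by omega
      have h2 := Int.le_of_dvd (by decide) ((dvd_add_left (dvd_mul_left _ e)).1 hd)
      have h3 : Nat.fib 14 ≤ Nat.fib u := Nat.fib_mono hm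
      have h4 : Nat.fib 14 = 377 := by decide
      have h5 : lucas 0 = 2 := rfl
      omega
  rcases Nat.lt_or_ge r 2 with hr2 | hr2
  · by_cases h0 : j = 0 ∧ r = 0
    · exact Or.inr (Or.inr h0)
    · have hl : lucas r ≤ 2 := by interval_cases r <;> decide
      obtain ⟨m, rfl⟩ := Nat.exists_eq_add_of_le' (show 2 ≤ m by omega)
      have h2 : Nat.fib u ≤ Nat.fib (m + 1) := Nat.fib_mono (by omega)
      have h3 : Nat.fib 7 ≤ Nat.fib u := Nat.fib_mono (by omega)
      have h4 : Nat.fib 7 ≤ Nat.fib m := Nat.fib_mono (by omega)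
      have h5 : Nat.fib 7 = 13 := by decide
      have h6 := Nat.fib_add_two (n := m)
      omega
  · have h1 := lucas_add_fib_lt (m := m) (by omega) hr2 hu (by omega)
    rcases Nat.lt_or_ge r 3 with hr3 | hr3
    · obtain rfl : r = 2 := by omega
      have h3 : Nat.fib 6 ≤ Nat.fib u := Nat.fib_mono (by omega)
      exact Or.inl ⟨h1, lt_of_lt_of_le (by decide) h3⟩
    · exact Or.inr (Or.inl ⟨h1, hr3⟩)

theorem not_fib_dvd_fib_sub_lucas_of_lt {m r j : ℕ} (hm : 14 ≤ m) (hj : j ≤ 6) (hr : r < m) :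
    ¬ (Nat.fib m : ℤ) ∣ Nat.fib (m + (r + j)) - lucas r := by
  intro hd
  rcases Nat.le_total (r + j) m with h | h
  · obtain ⟨u, hu⟩ := Nat.exists_eq_add_of_le h
    refine not_fib_dvd_lucas_add_fib (e := (-1) ^ (r + j)) hm hj hr (by simp) hu.symm ?_
    have h1 := fib_add_two_mul u (r + j)
    rw [add_comm u (r + j), ← hu] at h1
    rw [h1] at hd
    refine (dvd_sub (dvd_mul_left (Nat.fib m : ℤ) (lucas (r + j))) hd).trans (dvd_of_eq ?_)
    ring
  · obtain ⟨s, hs⟩ := Nat.exists_eq_add_of_le h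
    rw [hs] at hd
    refine not_fib_dvd_lucas_add_small (c := -((-1) ^ m * Nat.fib s)) hm hr (by omega) ?_ ?_
    · rw [abs_neg, abs_mul, abs_neg_one_pow, one_mul, Nat.abs_cast]
      exact_mod_cast Nat.fib_mono (show s ≤ 5 by omega)
    · have h1 := fib_add_cast m (m + s)
      have h2 := fib_add_cast m s
      have h3 := fib_cassini m
      rw [h1, h2] at hd
      refine (dvd_sub (dvd_mul_right (Nat.fib m : ℤ) (Nat.fib (m + s + 1)
        + (Nat.fib (m + 1) - Nat.fib m) * Nat.fib (s + 1)
        + (2 * Nat.fib m - Nat.fib (m + 1)) * Nat.fib s)) hd).trans (dvd_of_eq ?_)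
      rw [← h3]
      ring

/-- Shifting the index by `m` multiplies Fibonacci and Lucas numbers by a unit modulo `fib m`,
so the divisibility reduces to the case `k < m`. -/
theorem not_fib_dvd_fib_sub_lucas {m j : ℕ} (hm : 14 ≤ m) (hj : j ≤ 6) (k : ℕ) :
    ¬ (Nat.fib m : ℤ) ∣ Nat.fib (m + (k + j)) - lucas k := by
  induction k using Nat.strong_induction_on with
  | _ k ih =>
    rcases Nat.lt_or_ge k m with h | h
    · exact not_fib_dvd_fib_sub_lucas_of_lt hm hj h
    · obtain ⟨k, rfl⟩ := Nat.exists_eq_add_of_le h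
      intro hd
      refine ih k (by omega) ?_
      have hc : IsCoprime (Nat.fib m : ℤ) (Nat.fib (m + 1) - Nat.fib m) := by
        have := (Nat.isCoprime_iff_coprime.2 (Nat.fib_coprime_fib_succ m)).add_mul_left_right (-1)
        rwa [mul_neg_one, ← sub_eq_add_neg] at this
      refine hc.dvd_of_dvd_mul_left ?_
      rw [lucas_cast] at hd ⊢
      have h1 := fib_add_cast m (m + (k + j))
      have h2 := fib_add_cast m k
      have h3 := fib_add_cast m (k + 1)
      rw [← add_assoc] at h3
      rw [show m + k + j = m + (k + j) by ring, h1, h2, h3] at hd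
      refine (dvd_sub hd (dvd_mul_right (Nat.fib m : ℤ) (Nat.fib (m + (k + j) + 1)
        - (2 * Nat.fib (k + 1 + 1) - Nat.fib (k + 1))))).trans (dvd_of_eq ?_)
      ring

/-! ### Small first block

The modulus `420180200` is `200 * 11 * 31 * 61 * 101`. -/

theorem fib_mod_periodic : Function.Periodic (fun n => Nat.fib n % 420180200) 300 := by
  intro n
  have h1 : Nat.fib 299 ≡ 1 [MOD 420180200] := by decide +kernel
  have h2 : Nat.fib (299 + 1) ≡ 0 [MOD 420180200] := by decide +kernel
  have h3 := Nat.fib_add n 299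
  have h4 := (h1.mul_left (Nat.fib n)).add (h2.mul_left (Nat.fib (n + 1)))
  rw [← h3] at h4
  simpa [Nat.ModEq, add_assoc] using h4

theorem pow_ten_mod_periodic : Function.Periodic (fun d => 10 ^ (d + 3) % 420180200) 60 := by
  intro d
  have h1 : 10 ^ 63 ≡ 10 ^ 3 [MOD 420180200] := by decide +kernel
  have h2 := h1.mul_left (10 ^ d)
  rw [← pow_add, ← pow_add] at h2
  exact h2

set_option synthInstance.maxSize 1000 in
theorem fib_residue_check : ∀ k < 300, ∀ i < 19,
    (Nat.fib k * Nat.fib i + Nat.fib (k + 1) * Nat.fib (i + 1) + Nat.fib k) % 200 =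
      2 * Nat.fib (k + 1) % 200 →
    ∀ m < 14, 1 ≤ m ∧ m ≤ i + 1 ∧ i + 1 ≤ m + 6 → ∀ d < 60,
      (Nat.fib k * Nat.fib i + Nat.fib (k + 1) * Nat.fib (i + 1) + Nat.fib k) % 420180200 ≠
        (10 ^ (d + 3) * Nat.fib m + 2 * Nat.fib (k + 1)) % 420180200 := by
  decide +kernel

theorem fib_ne_concat_of_three_le {m j k d : ℕ} (hm1 : 1 ≤ m) (hm : m < 14) (hj : j ≤ 6)
    (hd : 3 ≤ d) : Nat.fib (m + (k + j)) ≠ 10 ^ d * Nat.fib m + lucas k := by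
  intro h
  obtain ⟨d, rfl⟩ := Nat.exists_eq_add_of_le' hd
  obtain ⟨i, hi⟩ := Nat.exists_eq_add_of_le' (show 1 ≤ m + j by omega)
  have hf (n : ℕ) : Nat.fib (n % 300) ≡ Nat.fib n [MOD 420180200] :=
    fib_mod_periodic.map_mod_nat n
  have hk0 : Nat.fib (k % 300) ≡ Nat.fib k [MOD 420180200] := hf k
  have hk1 : Nat.fib (k % 300 + 1) ≡ Nat.fib (k + 1) [MOD 420180200] :=
    (hf (k % 300 + 1)).symm.trans (by rw [Nat.mod_add_mod]; exact hf (k + 1))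
  have hd0 : 10 ^ (d % 60 + 3) ≡ 10 ^ (d + 3) [MOD 420180200] :=
    pow_ten_mod_periodic.map_mod_nat d
  have heq : Nat.fib k * Nat.fib i + Nat.fib (k + 1) * Nat.fib (i + 1) + Nat.fib k =
      10 ^ (d + 3) * Nat.fib m + 2 * Nat.fib (k + 1) := by
    rw [← Nat.fib_add, add_assoc, ← hi, show k + (m + j) = m + (k + j) by ring, h, add_assoc,
      lucas_add_fib]
  have hmod : Nat.fib (k % 300) * Nat.fib i + Nat.fib (k % 300 + 1) * Nat.fib (i + 1)
      + Nat.fib (k % 300) ≡ 10 ^ (d % 60 + 3) * Nat.fib m + 2 * Nat.fib (k % 300 + 1)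
      [MOD 420180200] :=
    (((hk0.mul_right _).add (hk1.mul_right _)).add hk0).trans
      (heq ▸ ((hd0.mul_right _).add (hk1.mul_left 2)).symm)
  refine fib_residue_check (k % 300) (Nat.mod_lt _ (by decide)) i (by omega) ?_ m hm
    ⟨hm1, by omega, by omega⟩ (d % 60) (Nat.mod_lt _ (by decide)) hmod
  have h200 : 10 ^ (d % 60 + 3) * Nat.fib m ≡ 0 [MOD 200] :=
    Nat.modEq_zero_iff_dvd.2 (dvd_mul_of_dvd_left
      (dvd_trans (by decide) (pow_dvd_pow 10 (Nat.le_add_left 3 _))) _)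
  have := (hmod.of_dvd (show 200 ∣ 420180200 by decide)).trans (h200.add_right _)
  rwa [zero_add] at this

set_option synthInstance.maxSize 1000 in
theorem fib_concat_check : ∀ m < 14, ∀ k < 12, ∀ j < 7, ∀ d < 3,
    lucas k < 10 ^ d ∧ 10 ^ d ≤ 10 * lucas k ∧
      Nat.fib (m + (k + j)) = 10 ^ d * Nat.fib m + lucas k →
    Nat.fib (m + (k + j)) ∈ [1, 2, 3, 13, 21, 34] := by
  decide +kernel

theorem fib_eq_concat_fib_lucas :
    {x : ℕ | ∃ n m k : ℕ,
        x = Nat.fib n ∧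
        Nat.fib n = 10 ^ (Nat.log 10 (lucas k) + 1) * Nat.fib m + lucas k} =
      ({1, 2, 3, 13, 21, 34} : Set ℕ) := by
  ext x
  constructor
  · rintro ⟨n, m, k, rfl, h⟩
    have hlt : lucas k < 10 ^ (Nat.log 10 (lucas k) + 1) := Nat.lt_pow_succ_log_self (by decide) _
    have hle : 10 ^ (Nat.log 10 (lucas k) + 1) ≤ 10 * lucas k := by
      rw [pow_succ']
      exact Nat.mul_le_mul_left _ (Nat.pow_log_le_self 10 (lucas_pos k).ne')
    generalize Nat.log 10 (lucas k) + 1 = d at *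
    have hk := lucas_pos k
    rcases Nat.eq_zero_or_pos m with rfl | hm
    · rw [Nat.fib_zero, mul_zero, zero_add] at h
      have := lt_three_of_lucas_eq_fib h.symm
      rw [h]
      interval_cases k <;> simp [lucas]
    have hfm : 0 < Nat.fib m := Nat.fib_pos.2 hm
    have hlow : k + m ≤ n := add_le_of_lucas_mul_fib_lt hm (by nlinarith)
    have hupp : n ≤ k + m + 6 := by
      rcases Nat.eq_zero_or_pos k with rfl | hk0
      · have := lt_add_six_of_fib_le (n := n) hm (by
          have hd : d = 1 := by
            have h20 : 10 ^ d < 10 ^ 2 := lt_of_le_of_lt hle (by decide)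
            have hd2 := (Nat.pow_lt_pow_iff_right (by decide)).1 h20
            have : d ≠ 0 := by rintro rfl; exact absurd hlt (by decide)
            omega
          have h0 : lucas 0 = 2 := rfl
          rw [h, hd, h0]
          omega)
        omega
      · have := lt_add_six_of_fib_le (n := n) (show 1 ≤ k + m + 1 by omega) (by
          have := lucas_mul_fib_le hk0 m
          nlinarith)
        omega
    obtain ⟨j, rfl⟩ := Nat.exists_eq_add_of_le hlow
    rw [show k + m + j = m + (k + j) by ring] at *
    have hj : j ≤ 6 := by omega
    rcases Nat.lt_or_ge m 14 with hm14 | hm14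
    · rcases Nat.lt_or_ge d 3 with hd | hd
      · have hk12 : k < 12 := by
          have h1 : 10 ^ d ≤ 10 ^ 2 := Nat.pow_le_pow_right (by decide) (by omega)
          have h2 := fib_le_lucas k
          exact Nat.fib_mono.reflect_lt
            (lt_of_le_of_lt h2 (hlt.trans_le (h1.trans (by decide : 10 ^ 2 ≤ Nat.fib 12))))
        simpa using fib_concat_check m hm14 k hk12 j (by omega) d hd ⟨hlt, hle, h⟩
      · exact absurd h (fib_ne_concat_of_three_le hm hm14 hj hd)
    · refine absurd ?_ (not_fib_dvd_fib_sub_lucas hm14 hj k)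
      rw [h]
      push_cast
      rw [add_sub_cancel_right]
      exact dvd_mul_left _ _
  · rintro (rfl | rfl | rfl | rfl | rfl | rfl)
    · exact ⟨1, 0, 1, by norm_num [lucas]⟩
    · exact ⟨3, 0, 0, by norm_num [lucas, Nat.fib_add_two]⟩
    · exact ⟨4, 0, 2, by norm_num [lucas, Nat.fib_add_two]⟩
    · exact ⟨7, 1, 2, by norm_num [lucas, Nat.fib_add_two]⟩
    · exact ⟨8, 3, 1, by norm_num [lucas, Nat.fib_add_two]⟩
    · exact ⟨9, 4, 3, by norm_num [lucas, Nat.fib_add_two]⟩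
end

section
/- There are no nonnegative integers n, m, k with 1 ≤ k ≤ 200 and 0 ≤ m ≤ 200 satisfying F_n = 10^d L_m + F_k (d the number of decimal digits of F_k) other than those giving F_n ∈ {13, 21}. -/
theorem fib_ne_of_lt_of_lt {c x : ℕ} (h₁ : Nat.fib c < x) (h₂ : x < Nat.fib (c + 1)) (n : ℕ) :
    Nat.fib n ≠ x := by
  rintro rfl
  have hc : c < n := Nat.fib_mono.reflect_lt h₁
  exact absurd (Nat.fib_mono (Nat.succ_le_of_lt hc)) h₂.not_ge

/-- If `D * lucas m` and `D * lucas m + f` lie in the consecutive Fibonacci gaps starting at `c` and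
`c + 1` for `m = M` and `m = M + 1`, then the same pattern persists for all larger `m`. -/
theorem mul_lucas_add_mem_fib_gap {D f c M : ℕ}
    (h₀ : Nat.fib c ≤ D * lucas M) (h₀' : D * lucas M + f < Nat.fib (c + 1))
    (h₁ : Nat.fib (c + 1) ≤ D * lucas (M + 1))
    (h₁' : D * lucas (M + 1) + f < Nat.fib (c + 2)) (i : ℕ) :
    Nat.fib (c + i) ≤ D * lucas (M + i) ∧ D * lucas (M + i) + f < Nat.fib (c + i + 1) := by
  induction i using Nat.twoStepInduction with
  | zero => exact ⟨h₀, h₀'⟩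
  | one => exact ⟨h₁, h₁'⟩
  | more i ih₀ ih₁ =>
    have hl : D * lucas (M + (i + 2)) = D * lucas (M + (i + 1)) + D * lucas (M + i) := by
      rw [← mul_add]; rfl
    have hf : Nat.fib (c + (i + 2)) = Nat.fib (c + i) + Nat.fib (c + i + 1) := Nat.fib_add_two
    have hf' : Nat.fib (c + (i + 2) + 1) = Nat.fib (c + i + 1) + Nat.fib (c + (i + 1) + 1) :=
      Nat.fib_add_two
    rw [← add_assoc c i 1] at ih₁ hf'
    omega

/-- The Fibonacci gap containing `10 ^ d * lucas m + fib k` for small `m`; the starting index is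
guessed from `log 10 / log φ ≈ 4.785`. -/
theorem small_lucas_gap : ∀ k < 200, ∀ m < 7,
    (fun D f b : ℕ ↦ (D * lucas m + f = 13 ∨ D * lucas m + f = 21) ∨
      ∃ e < 5, Nat.fib (b + e) < D * lucas m + f ∧ D * lucas m + f < Nat.fib (b + e + 1))
      (10 ^ (Nat.log 10 (Nat.fib (k + 1)) + 1)) (Nat.fib (k + 1))
      (m + (Nat.log 10 (Nat.fib (k + 1)) + 1) * 4785 / 1000) := by
  decide +kernel

theorem lucas_gap_seven : ∀ k < 200,
    (fun D f b : ℕ ↦ ∃ e < 4, Nat.fib (b + e) ≤ D * lucas 7 ∧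
      D * lucas 7 + f < Nat.fib (b + e + 1) ∧ Nat.fib (b + e + 1) ≤ D * lucas 8 ∧
      D * lucas 8 + f < Nat.fib (b + e + 2))
      (10 ^ (Nat.log 10 (Nat.fib (k + 1)) + 1)) (Nat.fib (k + 1))
      (7 + (Nat.log 10 (Nat.fib (k + 1)) + 1) * 4785 / 1000) := by
  decide +kernel

theorem search_lucas_fib (n m k d : ℕ) (hk1 : 1 ≤ k) (hk : k ≤ 200) (hm : m ≤ 200)
    (hd : d = Nat.log 10 (Nat.fib k) + 1)
    (heq : Nat.fib n = 10 ^ d * lucas m + Nat.fib k) :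
    Nat.fib n ∈ ({13, 21} : Set ℕ) := by
  obtain ⟨k, rfl⟩ := Nat.exists_eq_add_of_le' hk1
  subst hd
  rcases lt_or_ge m 7 with hm7 | hm7
  · rcases small_lucas_gap k (by omega) m hm7 with h | ⟨e, -, h₁, h₂⟩
    · rwa [← heq] at h
    · exact absurd heq (fib_ne_of_lt_of_lt h₁ h₂ n)
  · obtain ⟨i, rfl⟩ := Nat.exists_eq_add_of_le hm7
    obtain ⟨e, -, h₀, h₀', h₁, h₁'⟩ := lucas_gap_seven k (by omega)
    obtain ⟨hlow, hupp⟩ := mul_lucas_add_mem_fib_gap h₀ h₀' h₁ h₁' i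
    have hpos : 0 < Nat.fib (k + 1) := Nat.fib_pos.2 k.succ_pos
    exact absurd heq (fib_ne_of_lt_of_lt (by omega) hupp n)
end
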